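/- (Lemma: one-round contraction of the gradient-tracking error, convex case.) With C = (1/m) ∑_{k=1}^m ‖g_k − ∇L_k(θ*)‖², ε = (1/m) ∑_{k=1}^m ‖θ̃_k − γ̄‖², and C⁺(𝒫) = (1/m)·( ∑_{k∈𝒫} ‖∇L_k(θ̃_k) − ∇L_k(θ*)‖² + ∑_{k∉𝒫} ‖g_k − ∇L_k(θ*)‖² ), the inequality E_𝒫[ C⁺(𝒫) ] ≤ ( 1 − P/m )·C + 2L²·(P/m)·ε + 4L·(P/m)·( ℓ(γ̄) − ℓ(θ*) ) holds. -/

import Mathlib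

open scoped RealInnerProductSpace

lemma aux_line {d : ℕ} (f : EuclideanSpace ℝ (Fin d) → ℝ) (hf : Differentiable ℝ f)
    (x v : EuclideanSpace ℝ (Fin d)) (t : ℝ) :
    HasDerivAt (fun s : ℝ => f (x + s • v)) (inner ℝ (gradient f (x + t • v)) v) t := by
  have h1 : HasDerivAt (fun s : ℝ => x + s • v) v t := by
    simpa using ((hasDerivAt_id t).smul_const v).const_add x
  have h2 := (hf (x + t • v)).hasGradientAt.hasFDerivAt
  have h3 := h2.comp_hasDerivAt t h1
  simpa [Function.comp_def] using h3

lemma aux_convex {d : ℕ} (f : EuclideanSpace ℝ (Fin d) → ℝ) (hf : Differentiable ℝ f)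
    (hc : ConvexOn ℝ Set.univ f) (x v : EuclideanSpace ℝ (Fin d)) :
    f x + inner ℝ (gradient f x) v ≤ f (x + v) := by
  have h0 := aux_line f hf x v 0
  have hcv : ConvexOn ℝ Set.univ (fun s : ℝ => f (x + s • v)) := by
    refine ⟨convex_univ, ?_⟩
    intro a _ b _ p q hp hq hpq
    have := hc.2 (Set.mem_univ (x + a • v)) (Set.mem_univ (x + b • v)) hp hq hpq
    have e : p • (x + a • v) + q • (x + b • v) = x + (p • a + q • b) • v := by
      have : x = (p + q) • x := by rw [hpq, one_smul]
      conv_rhs => rw [this]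
      simp only [smul_eq_mul]
      module
    rw [e] at this
    exact this
  have := hcv.le_slope_of_hasDerivAt (Set.mem_univ 0) (Set.mem_univ 1) one_pos h0
  simp [slope_def_field] at this ⊢
  linarith

lemma aux_descent {d : ℕ} (f : EuclideanSpace ℝ (Fin d) → ℝ) (hf : Differentiable ℝ f) (L : ℝ)
    (hs : ∀ x y, ‖gradient f x - gradient f y‖ ≤ L * ‖x - y‖)
    (x v : EuclideanSpace ℝ (Fin d)) :
    f (x + v) ≤ f x + inner ℝ (gradient f x) v + L / 2 * ‖v‖ ^ 2 := by
  have hd : ∀ t : ℝ, HasDerivAt (fun s : ℝ => f (x + s • v) - s * inner ℝ (gradient f x) v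
      - s ^ 2 * (L / 2 * ‖v‖ ^ 2))
      (inner ℝ (gradient f (x + t • v)) v - inner ℝ (gradient f x) v
        - 2 * t * (L / 2 * ‖v‖ ^ 2)) t := by
    intro t
    have h1 := (aux_line f hf x v t).sub ((hasDerivAt_id t).mul_const (inner ℝ (gradient f x) v))
    have h2 := h1.sub ((hasDerivAt_pow 2 t).mul_const (L / 2 * ‖v‖ ^ 2))
    refine HasDerivAt.congr_deriv h2 ?_
    norm_num
  have ha := antitoneOn_of_deriv_nonpos (convex_Icc (0 : ℝ) 1)
    (fun t _ => (hd t).continuousAt.continuousWithinAt)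
    (fun t _ => (hd t).differentiableAt.differentiableWithinAt)
    (by
      intro t ht
      rw [interior_Icc] at ht
      rw [(hd t).deriv, ← inner_sub_left]
      have h1 := real_inner_le_norm (gradient f (x + t • v) - gradient f x) v
      have h2 := hs (x + t • v) x
      rw [add_sub_cancel_left, norm_smul, Real.norm_of_nonneg ht.1.le] at h2
      have h3 := mul_le_mul_of_nonneg_right h2 (norm_nonneg v)
      nlinarith)
  have := ha (Set.left_mem_Icc.2 zero_le_one) (Set.right_mem_Icc.2 zero_le_one) zero_le_one
  simp at this ⊢
  linarith

lemma aux_cocoercive {d : ℕ} (f : EuclideanSpace ℝ (Fin d) → ℝ) (hf : Differentiable ℝ f)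
    (hc : ConvexOn ℝ Set.univ f) (L : ℝ) (hL : 0 < L)
    (hs : ∀ x y, ‖gradient f x - gradient f y‖ ≤ L * ‖x - y‖)
    (x y : EuclideanSpace ℝ (Fin d)) :
    ‖gradient f y - gradient f x‖ ^ 2 ≤
      2 * L * (f y - f x - inner ℝ (gradient f x) (y - x)) := by
  set w := gradient f y - gradient f x with hw
  have h1 := aux_descent f hf L hs y (-(L⁻¹ • w))
  have h2 := aux_convex f hf hc x (y - x + -(L⁻¹ • w))
  have e : x + (y - x + -(L⁻¹ • w)) = y + -(L⁻¹ • w) := by abel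
  rw [e, inner_add_right] at h2
  have h3 : inner ℝ (gradient f y) (-(L⁻¹ • w)) - inner ℝ (gradient f x) (-(L⁻¹ • w))
      = - (L⁻¹ * ‖w‖ ^ 2) := by
    rw [← inner_sub_left, ← hw, inner_neg_right, real_inner_smul_right,
      real_inner_self_eq_norm_sq]
  have h4 : L / 2 * ‖-(L⁻¹ • w)‖ ^ 2 = L⁻¹ * ‖w‖ ^ 2 / 2 := by
    rw [norm_neg, norm_smul, Real.norm_of_nonneg (inv_pos.2 hL).le]
    field_simp
  rw [h4] at h1
  have h5 : L⁻¹ * ‖w‖ ^ 2 / 2 ≤ f y - f x - inner ℝ (gradient f x) (y - x) := by linarith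
  have h6 := mul_le_mul_of_nonneg_left h5 (by positivity : 0 ≤ 2 * L)
  calc ‖w‖ ^ 2 = 2 * L * (L⁻¹ * ‖w‖ ^ 2 / 2) := by field_simp
    _ ≤ _ := h6

lemma aux_count (m P : ℕ) (hm : 1 ≤ m) (hPm : P ≤ m) (b : Fin m → ℝ) :
    ∑ S ∈ Finset.powersetCard P (Finset.univ : Finset (Fin m)), ∑ k ∈ Sᶜ, b k =
      ((Finset.powersetCard P (Finset.univ : Finset (Fin m))).card : ℝ) *
        ((1 - (P : ℝ) / m) * ∑ k, b k) := by
  have h1 : ∑ S ∈ Finset.powersetCard P (Finset.univ : Finset (Fin m)), ∑ k ∈ Sᶜ, b k =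
      ∑ k, ∑ S ∈ Finset.powersetCard P ((Finset.univ : Finset (Fin m)).erase k), b k := by
    apply Finset.sum_comm'
    intro S k
    simp only [Finset.mem_powersetCard, Finset.mem_compl, Finset.subset_univ, true_and,
      Finset.mem_univ, and_true, Finset.subset_erase]
    tauto
  rw [h1]
  simp only [Finset.sum_const, Finset.card_powersetCard, Finset.card_erase_of_mem,
    Finset.mem_univ, Finset.card_univ, Fintype.card_fin, nsmul_eq_mul]
  rw [← Finset.mul_sum, ← mul_assoc]
  congr 1
  obtain ⟨n, rfl⟩ : ∃ n, m = n + 1 := ⟨m - 1, by omega⟩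
  have h2 := Nat.choose_mul_succ_eq n P
  have h3 : (n.choose P : ℝ) * ((n : ℝ) + 1) = ((n + 1).choose P : ℝ) * ((n : ℝ) + 1 - P) := by
    have : ((n.choose P * (n + 1) : ℕ) : ℝ) = (((n + 1).choose P * (n + 1 - P) : ℕ) : ℝ) := by
      rw [h2]
    rw [Nat.cast_mul, Nat.cast_mul, Nat.cast_sub hPm] at this
    push_cast at this
    exact this
  have h4 : (n : ℝ) + 1 ≠ 0 := by positivity
  simp only [Nat.add_sub_cancel]
  push_cast
  field_simp
  linarith



/-- one-round contraction of the gradient-tracking error, convex case. -/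
theorem gradient_tracking_contraction_convex
    (d m P : ℕ) (hd : 1 ≤ d) (hm : 1 ≤ m) (hP1 : 1 ≤ P) (hPm : P ≤ m)
    (α L : ℝ) (hα : 0 < α) (hL : 0 < L)
    (Lk : Fin m → EuclideanSpace ℝ (Fin d) → ℝ)
    (hdiff : ∀ k, Differentiable ℝ (Lk k))
    (hconv : ∀ k, ConvexOn ℝ Set.univ (Lk k))
    (hsmooth : ∀ k x y, ‖gradient (Lk k) x - gradient (Lk k) y‖ ≤ L * ‖x - y‖)
    (ℓ : EuclideanSpace ℝ (Fin d) → ℝ)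
    (hℓ : ∀ θ, ℓ θ = (m : ℝ)⁻¹ * ∑ k, Lk k θ)
    (θstar : EuclideanSpace ℝ (Fin d)) (hmin : ∀ θ, ℓ θstar ≤ ℓ θ)
    (θbar : EuclideanSpace ℝ (Fin d))
    (g : Fin m → EuclideanSpace ℝ (Fin d))
    (h : EuclideanSpace ℝ (Fin d)) (hh : h = (m : ℝ)⁻¹ • ∑ k, g k)
    (γbar : EuclideanSpace ℝ (Fin d)) (hγbar : γbar = θbar + α⁻¹ • h)
    (θt : Fin m → EuclideanSpace ℝ (Fin d))
    (hfoc : ∀ k, gradient (Lk k) (θt k) - g k + α • (θt k - θbar) = 0) :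
    (∑ S ∈ Finset.powersetCard P (Finset.univ : Finset (Fin m)),
        (m : ℝ)⁻¹ * (∑ k ∈ S, ‖gradient (Lk k) (θt k) - gradient (Lk k) θstar‖ ^ 2 +
          ∑ k ∈ Sᶜ, ‖g k - gradient (Lk k) θstar‖ ^ 2)) /
      ((Finset.powersetCard P (Finset.univ : Finset (Fin m))).card : ℝ) ≤
    (1 - (P : ℝ) / m) * ((m : ℝ)⁻¹ * ∑ k, ‖g k - gradient (Lk k) θstar‖ ^ 2) +
      2 * L ^ 2 * ((P : ℝ) / m) * ((m : ℝ)⁻¹ * ∑ k, ‖θt k - γbar‖ ^ 2) +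
      4 * L * ((P : ℝ) / m) * (ℓ γbar - ℓ θstar) := by
  have hm0 : (0 : ℝ) < m := by exact_mod_cast hm
  set N : ℝ := ((Finset.powersetCard P (Finset.univ : Finset (Fin m))).card : ℝ) with hN
  have hN0 : 0 < N := by
    rw [hN, Finset.card_powersetCard, Finset.card_univ, Fintype.card_fin]
    exact_mod_cast Nat.choose_pos hPm
  set a : Fin m → ℝ := fun k => ‖gradient (Lk k) (θt k) - gradient (Lk k) θstar‖ ^ 2 with ha
  set b : Fin m → ℝ := fun k => ‖g k - gradient (Lk k) θstar‖ ^ 2 with hb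
  -- stationarity of the average at the minimizer
  have hgrad : ∑ k, inner ℝ (gradient (Lk k) θstar) (γbar - θstar) = 0 := by
    have hder : HasDerivAt (fun s : ℝ => ∑ k, Lk k (θstar + s • (γbar - θstar)))
        (∑ k, inner ℝ (gradient (Lk k) (θstar + (0 : ℝ) • (γbar - θstar))) (γbar - θstar)) 0 :=
      HasDerivAt.fun_sum fun k _ => aux_line (Lk k) (hdiff k) θstar (γbar - θstar) 0
    have hmin' : IsLocalMin (fun s : ℝ => ∑ k, Lk k (θstar + s • (γbar - θstar))) 0 := by
      refine Filter.Eventually.of_forall fun s => ?_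
      have := hmin (θstar + s • (γbar - θstar))
      rw [hℓ, hℓ] at this
      have := le_of_mul_le_mul_left this (inv_pos.2 hm0)
      simpa using this
    have := hmin'.hasDerivAt_eq_zero hder
    simpa using this
  have hsum : ∑ k, a k ≤ 2 * L ^ 2 * ∑ k, ‖θt k - γbar‖ ^ 2
      + 4 * L * (∑ k, Lk k γbar - ∑ k, Lk k θstar) := by
    have hk : ∀ k, a k ≤ 2 * L ^ 2 * ‖θt k - γbar‖ ^ 2 + 4 * L * (Lk k γbar - Lk k θstar
        - inner ℝ (gradient (Lk k) θstar) (γbar - θstar)) := by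
      intro k
      have h1 := aux_cocoercive (Lk k) (hdiff k) (hconv k) L hL (hsmooth k) θstar γbar
      have h2 := hsmooth k (θt k) γbar
      have h3 := norm_add_le (gradient (Lk k) (θt k) - gradient (Lk k) γbar)
        (gradient (Lk k) γbar - gradient (Lk k) θstar)
      rw [sub_add_sub_cancel] at h3
      have h4 := pow_le_pow_left₀ (norm_nonneg _) h3 2
      have h5 := pow_le_pow_left₀ (norm_nonneg _) h2 2
      have h6 := add_sq_le (a := ‖gradient (Lk k) (θt k) - gradient (Lk k) γbar‖)
        (b := ‖gradient (Lk k) γbar - gradient (Lk k) θstar‖)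
      simp only [ha]
      rw [mul_pow] at h5
      linarith
    refine (Finset.sum_le_sum fun k _ => hk k).trans (le_of_eq ?_)
    rw [Finset.sum_add_distrib, ← Finset.mul_sum, ← Finset.mul_sum, Finset.sum_sub_distrib,
      Finset.sum_sub_distrib, hgrad, sub_zero]
  have hLHS : ∑ S ∈ Finset.powersetCard P (Finset.univ : Finset (Fin m)),
      (m : ℝ)⁻¹ * (∑ k ∈ S, a k + ∑ k ∈ Sᶜ, b k) =
      N * ((m : ℝ)⁻¹ * ((P : ℝ) / m * ∑ k, a k + (1 - (P : ℝ) / m) * ∑ k, b k)) := by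
    have e : ∀ S : Finset (Fin m), ∑ k ∈ S, a k = ∑ k, a k - ∑ k ∈ Sᶜ, a k := fun S => by
      rw [← Finset.sum_add_sum_compl S a]; ring
    have e2 : ∀ S ∈ Finset.powersetCard P (Finset.univ : Finset (Fin m)),
        (m : ℝ)⁻¹ * (∑ k ∈ S, a k + ∑ k ∈ Sᶜ, b k) =
        (m : ℝ)⁻¹ * (∑ k, a k - ∑ k ∈ Sᶜ, a k + ∑ k ∈ Sᶜ, b k) := fun S _ => by rw [e S]
    rw [Finset.sum_congr rfl e2, ← Finset.mul_sum, Finset.sum_add_distrib, Finset.sum_sub_distrib,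
      aux_count m P hm hPm a, aux_count m P hm hPm b, Finset.sum_const, nsmul_eq_mul, ← hN]
    ring
  rw [hLHS, mul_div_cancel_left₀ _ hN0.ne', hℓ, hℓ]
  have hc : 0 ≤ (m : ℝ)⁻¹ * ((P : ℝ) / m) := by positivity
  have := mul_le_mul_of_nonneg_left hsum hc
  linarith
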